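/- arXiv:1612.00097 — 2 statements merged into one kernel-verified Lean document; each statement's English description precedes it below -/
import Mathlib

section
/- Let V be a finite-dimensional complex vector space, let D ⊆ ℤ² be a finite diagram, and let K be a system of corner configurations for D. Let z ∈ ℤ² be a point whose first coordinate differs from the first coordinate of every point of D, of every a with (a,Δ) ∈ K, and of every point of every Δ with (a,Δ) ∈ K, and whose second coordinate likewise differs from all their second coordinates. Then there is an injective GL(V)-equivariant linear map from the direct sum ⊕_{(a,Δ) ∈ K} ⊕_{x ∈ Δ} V[(D ∪ {a})_{a→x}] into V[D ∪ {z}]. -/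
open scoped TensorProduct

/-- The Young symmetrizer operator of a finite diagram `D ⊆ ℤ²` on `V^{⊗D}`. -/
noncomputable def youngOp (V : Type*) [AddCommGroup V] [Module ℂ V]
    (D : Finset (ℤ × ℤ)) :
    (⨂[ℂ] _ : D, V) →ₗ[ℂ] (⨂[ℂ] _ : D, V) :=
  ∑ p : Equiv.Perm D, ∑ q : Equiv.Perm D,
    if (∀ x : D, ((p x : ℤ × ℤ)).1 = (x : ℤ × ℤ).1) ∧
        (∀ x : D, ((q x : ℤ × ℤ)).2 = (x : ℤ × ℤ).2) then
      ((Equiv.Perm.sign q : ℤ) : ℂ) •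
        (PiTensorProduct.reindex ℂ (fun _ : D => V) (q * p)).toLinearMap
    else 0

/-- The generalized Schur module `V[D] = V^{⊗D}·y_D`. -/
noncomputable def schurModule (V : Type*) [AddCommGroup V] [Module ℂ V]
    (D : Finset (ℤ × ℤ)) : Submodule ℂ (⨂[ℂ] _ : D, V) :=
  LinearMap.range (youngOp V D)

/-- The diagonal action of `g ∈ GL(V)` on the tensor power `V^{⊗D}`. -/
noncomputable def glOp (V : Type*) [AddCommGroup V] [Module ℂ V]
    (D : Finset (ℤ × ℤ)) (g : V ≃ₗ[ℂ] V) :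
    (⨂[ℂ] _ : D, V) →ₗ[ℂ] (⨂[ℂ] _ : D, V) :=
  PiTensorProduct.map (fun _ : D => g.toLinearMap)

/-- The James–Peel row move `R_x^{x'}`: each cell `(x.1, q) ∈ D` with
`(x'.1, q) ∉ D` is replaced by `(x'.1, q)`; all other cells are unchanged. -/
def rowMove (x x' : ℤ × ℤ) (D : Finset (ℤ × ℤ)) : Finset (ℤ × ℤ) :=
  D.image (fun c => if c.1 = x.1 ∧ (x'.1, c.2) ∉ D then (x'.1, c.2) else c)

/-- The James–Peel column move `C_x^{x'}`. -/
def colMove (x x' : ℤ × ℤ) (D : Finset (ℤ × ℤ)) : Finset (ℤ × ℤ) :=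
  D.image (fun c => if c.2 = x.2 ∧ (c.1, x'.2) ∉ D then (c.1, x'.2) else c)

/-- `D_{x → x'} = R_x^{x'} C_x^{x'} D`. -/
def jpMove (x x' : ℤ × ℤ) (D : Finset (ℤ × ℤ)) : Finset (ℤ × ℤ) :=
  rowMove x x' (colMove x x' D)

/-- A list of points of `ℤ²` is a transversal if no two of its points share a
first or a second coordinate. -/
def IsTransversal (L : List (ℤ × ℤ)) : Prop :=
  L.Pairwise (fun u v => u.1 ≠ v.1 ∧ u.2 ≠ v.2)

/-- `(a, Δ)` is a corner configuration for `D` (with `Δ` a finite totally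
ordered set, modelled as a list ordered by position): `{a} ∪ Δ` is a transversal
disjoint from `D`; `a|x ∉ D` and `x|a ∉ D` for `x ∈ Δ`; and `y|x ∈ D` whenever
`x < y` in `Δ`. -/
def IsCornerConfig (D : Finset (ℤ × ℤ)) (a : ℤ × ℤ) (Δ : List (ℤ × ℤ)) : Prop :=
  IsTransversal (a :: Δ) ∧
  (∀ x ∈ a :: Δ, x ∉ D) ∧
  (∀ x ∈ Δ, (a.1, x.2) ∉ D ∧ (x.1, a.2) ∉ D) ∧
  (∀ p q : Fin Δ.length, p < q → ((Δ.get q).1, (Δ.get p).2) ∈ D)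

/-- `K` is a system of corner configurations for `D` (a finite totally ordered
set of corner configurations, modelled as a list ordered by position). -/
def IsCornerSystem (D : Finset (ℤ × ℤ)) (K : List ((ℤ × ℤ) × List (ℤ × ℤ))) : Prop :=
  (∀ e ∈ K, IsCornerConfig D e.1 e.2) ∧
  IsTransversal (K.map Prod.fst) ∧
  (∀ e ∈ K, ∀ e' ∈ K, IsTransversal (e.1 :: e'.2)) ∧
  (∀ p q : Fin K.length, p < q → ∀ x ∈ (K.get p).2, ∀ y ∈ (K.get q).2,
    ((K.get q).1.1, (K.get p).1.2) ∈ D ∨ ((K.get q).1.1, x.2) ∈ D ∨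
      (y.1, (K.get p).1.2) ∈ D ∨ (y.1, x.2) ∈ D)

/-- The diagram `(D ∪ {a})_{a → x}` attached to the member `x` of the corner
configuration `(a, Δ)` of the system `K`, where `i = (p, t)` selects the `p`-th
corner configuration of `K` and the `t`-th member of its `Δ`. -/
def cornerDiagram (D : Finset (ℤ × ℤ)) (K : List ((ℤ × ℤ) × List (ℤ × ℤ)))
    (i : Σ p : Fin K.length, Fin (K.get p).2.length) : Finset (ℤ × ℤ) :=
  jpMove (K.get i.1).1 ((K.get i.1).2.get i.2) (insert (K.get i.1).1 D)

namespace CornerAux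

open MonoidAlgebra

section Alg

variable {ι : Type} [Fintype ι] [DecidableEq ι]

/-- The row symmetrizer of a row function. -/
noncomputable def symA (r : ι → ℤ) : MonoidAlgebra ℂ (Equiv.Perm ι) :=
  ∑ p : Equiv.Perm ι, if (∀ x, r (p x) = r x) then of ℂ (Equiv.Perm ι) p else 0

/-- The column antisymmetrizer of a column function. -/
noncomputable def altB (c : ι → ℤ) : MonoidAlgebra ℂ (Equiv.Perm ι) :=
  ∑ q : Equiv.Perm ι, if (∀ x, c (q x) = c x) then
    ((Equiv.Perm.sign q : ℤ) : ℂ) • of ℂ (Equiv.Perm ι) q else 0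

theorem of_mul_symA (r : ι → ℤ) (σ : Equiv.Perm ι) (h : ∀ x, r (σ x) = r x) :
    of ℂ (Equiv.Perm ι) σ * symA r = symA r := by
  unfold symA
  rw [Finset.mul_sum]
  refine Fintype.sum_equiv (Equiv.mulLeft σ) _ _ fun p => ?_
  have : (∀ x, r ((σ * p) x) = r x) ↔ (∀ x, r (p x) = r x) := by
    simp [Equiv.Perm.mul_apply, h]
  simp only [Equiv.coe_mulLeft, this, map_mul, mul_ite, mul_zero]

theorem altB_mul_of (c : ι → ℤ) (σ : Equiv.Perm ι) (h : ∀ x, c (σ x) = c x) :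
    altB c * of ℂ (Equiv.Perm ι) σ = ((Equiv.Perm.sign σ : ℤ) : ℂ) • altB c := by
  unfold altB
  rw [Finset.sum_mul, Finset.smul_sum]
  refine Fintype.sum_equiv (Equiv.mulRight σ) _ _ fun p => ?_
  have h1 : (∀ x, c ((p * σ) x) = c x) ↔ (∀ x, c (p x) = c x) := by
    simp only [Equiv.Perm.mul_apply]
    constructor
    · intro H x
      have := H (σ.symm x)
      have h2 := h (σ.symm x)
      rw [Equiv.apply_symm_apply] at this h2
      rw [this, h2]
    · intro H x
      rw [H, h]
  have h3 : ((Equiv.Perm.sign σ : ℤ) : ℂ) * ((Equiv.Perm.sign σ : ℤ) : ℂ) = 1 := by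
    rcases Int.units_eq_one_or (Equiv.Perm.sign σ) with h | h <;> simp [h]
  simp only [Equiv.coe_mulRight, h1, map_mul, ite_mul, zero_mul, smul_ite, smul_zero,
    smul_mul_assoc, smul_smul, Units.val_mul, Int.cast_mul]
  congr 2
  rw [mul_comm ((Equiv.Perm.sign p : ℤ) : ℂ), ← mul_assoc, h3, one_mul]

theorem conflict (c r : ι → ℤ) (q : Equiv.Perm ι)
    (h : ∃ u w, u ≠ w ∧ r u = r w ∧ c (q u) = c (q w)) :
    altB c * of ℂ (Equiv.Perm ι) q * symA r = 0 := by
  obtain ⟨u, w, huw, hr, hc⟩ := h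
  have h1 := of_mul_symA r (Equiv.swap u w) (by
    intro x; rw [Equiv.swap_apply_def]; split_ifs <;> simp_all)
  have h2 := altB_mul_of c (Equiv.swap (q u) (q w)) (by
    intro x; rw [Equiv.swap_apply_def]; split_ifs <;> simp_all)
  rw [Equiv.Perm.sign_swap (fun h => huw (q.injective h))] at h2
  have h3 : Equiv.swap (q u) (q w) * q = q * Equiv.swap u w := by
    rw [Equiv.mul_swap_eq_swap_mul]
  have h4 : altB c * of ℂ (Equiv.Perm ι) q * symA r
      = -(altB c * of ℂ (Equiv.Perm ι) q * symA r) := by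
    conv_lhs => rw [← h1, ← mul_assoc, mul_assoc (altB c), ← map_mul, ← h3, map_mul,
      ← mul_assoc, h2]
    simp
  have h5 : (2 : ℂ) • (altB c * of ℂ (Equiv.Perm ι) q * symA r) = 0 := by
    rw [two_smul]
    nth_rewrite 1 [h4]
    exact neg_add_cancel _
  exact (smul_eq_zero.mp h5).resolve_left two_ne_zero

theorem vanishG (c c0 r : ι → ℤ)
    (H : ∀ q : Equiv.Perm ι, (∀ x, c0 (q x) = c0 x) →
      ∃ u w, u ≠ w ∧ r u = r w ∧ c (q u) = c (q w)) :
    altB c * altB c0 * symA r = 0 := by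
  conv_lhs => rw [altB.eq_def c0]
  rw [Finset.mul_sum, Finset.sum_mul]
  refine Finset.sum_eq_zero fun q _ => ?_
  split_ifs with h
  · rw [mul_smul_comm, smul_mul_assoc, conflict _ _ _ (H q h), smul_zero]
  · simp

theorem diagG (c c0 r : ι → ℤ)
    (H : ∀ q : Equiv.Perm ι, (∀ x, c0 (q x) = c0 x) → (∀ x, c (q x) = c x) ∨
      ∃ u w, u ≠ w ∧ r u = r w ∧ c (q u) = c (q w)) :
    ∃ k : ℂ, k ≠ 0 ∧ altB c * altB c0 * symA r = k • (altB c * symA r) := by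
  classical
  refine ⟨((Finset.univ.filter fun q : Equiv.Perm ι =>
    (∀ x, c0 (q x) = c0 x) ∧ (∀ x, c (q x) = c x)).card : ℂ), ?_, ?_⟩
  · rw [Nat.cast_ne_zero, ← Nat.pos_iff_ne_zero, Finset.card_pos]
    exact ⟨1, by simp⟩
  · conv_lhs => rw [altB.eq_def c0]
    rw [Finset.mul_sum, Finset.sum_mul, Nat.cast_smul_eq_nsmul, ← Finset.sum_const,
      Finset.sum_filter]
    refine Finset.sum_congr rfl fun q _ => ?_
    by_cases h : ∀ x, c0 (q x) = c0 x
    · by_cases h' : ∀ x, c (q x) = c x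
      · rw [if_pos h, if_pos ⟨h, h'⟩, mul_smul_comm, altB_mul_of _ _ h', smul_smul]
        have h3 : ((Equiv.Perm.sign q : ℤ) : ℂ) * ((Equiv.Perm.sign q : ℤ) : ℂ) = 1 := by
          rcases Int.units_eq_one_or (Equiv.Perm.sign q) with h | h <;> simp [h]
        rw [h3, one_smul]
      · rw [if_pos h, if_neg (fun hh => h' hh.2), mul_smul_comm, smul_mul_assoc,
          conflict _ _ _ ((H q h).resolve_left h'), smul_zero]
    · rw [if_neg h, if_neg (fun hh => h hh.1)]; simp

theorem inclG (c0 r r0 : ι → ℤ)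
    (H : ∀ p : Equiv.Perm ι, (∀ x, r0 (p x) = r0 x) → (∀ x, r (p x) = r x) ∨
      ∃ u w, u ≠ w ∧ r u = r w ∧ c0 (p u) = c0 (p w)) :
    ∃ k : ℂ, k ≠ 0 ∧ altB c0 * symA r0 * symA r = k • (altB c0 * symA r) := by
  classical
  refine ⟨((Finset.univ.filter fun q : Equiv.Perm ι =>
    (∀ x, r0 (q x) = r0 x) ∧ (∀ x, r (q x) = r x)).card : ℂ), ?_, ?_⟩
  · rw [Nat.cast_ne_zero, ← Nat.pos_iff_ne_zero, Finset.card_pos]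
    exact ⟨1, by simp⟩
  · conv_lhs => rw [symA.eq_def r0]
    rw [Finset.mul_sum, Finset.sum_mul, Nat.cast_smul_eq_nsmul, ← Finset.sum_const,
      Finset.sum_filter]
    refine Finset.sum_congr rfl fun q _ => ?_
    by_cases h : ∀ x, r0 (q x) = r0 x
    · by_cases h' : ∀ x, r (q x) = r x
      · rw [if_pos h, if_pos ⟨h, h'⟩, mul_assoc, of_mul_symA _ _ h']
      · rw [if_pos h, if_neg (fun hh => h' hh.2),
          conflict _ _ _ ((H q h).resolve_left h')]
    · rw [if_neg h, if_neg (fun hh => h hh.1)]; simp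

theorem exists_regular (a : MonoidAlgebra ℂ (Equiv.Perm ι)) :
    ∃ w, a * w * a = a := by
  have : NeZero (Nat.card (Equiv.Perm ι) : ℂ) := ⟨by simp [Fintype.card_perm, Nat.factorial_ne_zero]⟩
  obtain ⟨e, he, hs⟩ := IsSemisimpleRing.ideal_eq_span_idempotent
    (Ideal.span {a} : Ideal (MonoidAlgebra ℂ (Equiv.Perm ι)))
  have h1 : a ∈ Ideal.span {e} := hs ▸ Ideal.mem_span_singleton_self a
  have h2 : e ∈ Ideal.span {a} := hs ▸ Ideal.mem_span_singleton_self e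
  obtain ⟨s, rfl⟩ := Ideal.mem_span_singleton'.mp h1
  obtain ⟨t, ht⟩ := Ideal.mem_span_singleton'.mp h2
  refine ⟨t, ?_⟩
  rw [mul_assoc, ht, mul_assoc, he.eq]

end Alg

section Ops

variable {ι : Type} [Fintype ι] [DecidableEq ι]
variable (V : Type*) [AddCommGroup V] [Module ℂ V]

/-- The permutation action on tensors as a monoid hom. -/
noncomputable def permHom : Equiv.Perm ι →* Module.End ℂ (⨂[ℂ] _ : ι, V) where
  toFun σ := (PiTensorProduct.reindex ℂ (fun _ : ι => V) σ).toLinearMap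
  map_one' := by
    refine LinearMap.ext fun x => ?_
    exact LinearEquiv.congr_fun (PiTensorProduct.reindex_refl (R := ℂ) (s := fun _ : ι => V)) x
  map_mul' σ τ := by
    refine LinearMap.ext fun x => ?_
    exact (PiTensorProduct.reindex_reindex (R := ℂ) (s := fun _ : ι => V) τ σ x).symm

/-- The action of the group algebra on tensors. -/
noncomputable def rho :
    MonoidAlgebra ℂ (Equiv.Perm ι) →ₐ[ℂ] Module.End ℂ (⨂[ℂ] _ : ι, V) :=
  MonoidAlgebra.lift ℂ _ _ (permHom V)

theorem rho_comm (g : V ≃ₗ[ℂ] V) (a : MonoidAlgebra ℂ (Equiv.Perm ι)) (t : ⨂[ℂ] _ : ι, V) :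
    PiTensorProduct.map (fun _ : ι => g.toLinearMap) (rho V a t)
      = rho V a (PiTensorProduct.map (fun _ : ι => g.toLinearMap) t) := by
  induction a using MonoidAlgebra.induction_on with
  | of σ =>
    simp only [rho, MonoidAlgebra.lift_of]
    exact PiTensorProduct.map_reindex (fun _ : ι => g.toLinearMap) σ t
  | add a b ha hb => simp [ha, hb]
  | smul c a ha => simp [ha]

theorem youngOp_eq (D : Finset (ℤ × ℤ)) (e : ι ≃ D) (t : ⨂[ℂ] _ : D, V) :
    youngOp V D t = PiTensorProduct.reindex ℂ (fun _ : ι => V) e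
      (rho V (altB (fun u => (e u : ℤ × ℤ).2) * symA (fun u => (e u : ℤ × ℤ).1))
        (PiTensorProduct.reindex ℂ (fun _ : D => V) e.symm t)) := by
  unfold youngOp altB symA
  rw [Finset.sum_mul_sum, Finset.sum_comm]
  simp only [map_sum, LinearMap.sum_apply]
  refine Fintype.sum_equiv e.symm.permCongr _ _ fun q => ?_
  refine Fintype.sum_equiv e.symm.permCongr _ _ fun p => ?_
  have h1 : (∀ x : ι, ((e (e.symm.permCongr p x) : ℤ × ℤ)).1 = (e x : ℤ × ℤ).1) ↔
      (∀ x : D, ((p x : ℤ × ℤ)).1 = (x : ℤ × ℤ).1) := by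
    rw [e.forall_congr_left]; simp [Equiv.permCongr_apply]
  have h2 : (∀ x : ι, ((e (e.symm.permCongr q x) : ℤ × ℤ)).2 = (e x : ℤ × ℤ).2) ↔
      (∀ x : D, ((q x : ℤ × ℤ)).2 = (x : ℤ × ℤ).2) := by
    rw [e.forall_congr_left]; simp [Equiv.permCongr_apply]
  simp only [h1, h2]
  by_cases hp : (∀ x : D, ((p x : ℤ × ℤ)).1 = (x : ℤ × ℤ).1)
  · by_cases hq : (∀ x : D, ((q x : ℤ × ℤ)).2 = (x : ℤ × ℤ).2)
    · rw [if_pos ⟨hp, hq⟩, if_pos hp, if_pos hq, smul_mul_assoc, ← map_mul, map_smul]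
      simp only [rho, MonoidAlgebra.lift_of, Equiv.Perm.sign_permCongr]
      simp only [LinearMap.smul_apply, map_smul]
      congr 1
      simp only [permHom, MonoidHom.coe_mk, OneHom.coe_mk, LinearEquiv.coe_coe]
      have k1 := PiTensorProduct.reindex_reindex (R := ℂ) (s := fun _ : D => V) e.symm
        (e.symm.permCongr q * e.symm.permCongr p) t
      have k2 := PiTensorProduct.reindex_reindex (R := ℂ) (s := fun _ : D => V)
        (e.symm.trans (e.symm.permCongr q * e.symm.permCongr p)) e t
      have k3 : (e.symm.trans (e.symm.permCongr q * e.symm.permCongr p)).trans e = q * p := by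
        refine Equiv.ext fun u => ?_
        simp [Equiv.permCongr_apply]
      rw [k3] at k2
      rw [← k2, ← k1]
    · rw [if_neg (fun h => hq h.2), if_neg hq]; simp
  · rw [if_neg (fun h => hp h.1), if_neg hp]; simp

end Ops

section Comb

/-- Row of a cell of `D ∪ {z}` after the moves. -/
def rowF (D : Finset (ℤ × ℤ)) (z a x u : ℤ × ℤ) : ℤ :=
  if u = z then x.1 else if u.1 = a.1 ∧ (x.1, u.2) ∉ D then x.1 else u.1

/-- Column of a cell of `D ∪ {z}` after the moves. -/
def colF (D : Finset (ℤ × ℤ)) (z a x u : ℤ × ℤ) : ℤ :=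
  if u = z then x.2 else if u.2 = a.2 ∧ (u.1, x.2) ∉ D then x.2 else u.2

theorem perm_stable {ι : Type} [Finite ι] (p : Equiv.Perm ι) (P : ι → Prop)
    (h : ∀ u, P u → P (p u)) (u : ι) (hu : P (p u)) : P u := by
  have hinj : Function.Injective (fun v : {u // P u} => (⟨p v.1, h _ v.2⟩ : {u // P u})) := by
    intro v w hvw
    exact Subtype.ext (p.injective (congrArg Subtype.val hvw))
  obtain ⟨v, hv⟩ := (Finite.injective_iff_surjective.mp hinj) ⟨p u, hu⟩
  have h1 : v.1 = u := p.injective (congrArg Subtype.val hv)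
  exact h1 ▸ v.2

variable {D : Finset (ℤ × ℤ)} {z : ℤ × ℤ}

theorem eq_z_or (u : ↥(insert z D)) : u.1 = z ∨ u.1 ∈ D := by
  have := u.2
  rwa [Finset.mem_insert] at this

theorem incl_comb (hzD : ∀ c ∈ D, z.1 ≠ c.1 ∧ z.2 ≠ c.2) (a x : ℤ × ℤ)
    (p : Equiv.Perm ↥(insert z D)) (hp : ∀ u, (p u).1.1 = u.1.1) :
    (∀ u, rowF D z a x (p u).1 = rowF D z a x u.1) ∨
      ∃ u w, u ≠ w ∧ rowF D z a x u.1 = rowF D z a x w.1 ∧ (p u).1.2 = (p w).1.2 := by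
  by_cases hs : ∀ u : ↥(insert z D), (u.1 ∈ D ∧ u.1.1 = a.1 ∧ (x.1, u.1.2) ∉ D) →
      ((p u).1 ∈ D ∧ (p u).1.1 = a.1 ∧ (x.1, (p u).1.2) ∉ D)
  · left
    intro u
    have h1 := hs u
    have h2 := perm_stable p _ hs u
    have h3 := eq_z_or u
    have h4 := eq_z_or (p u)
    have h5 := hp u
    have h6 := hzD u.1
    have h7 := hzD (p u).1
    unfold rowF
    grind
  · right
    push Not at hs
    obtain ⟨s, ⟨hsD, hsa, hsx⟩, hs2⟩ := hs
    have h5 := hp s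
    have h4 : (p s).1 ∈ D := by
      rcases eq_z_or (p s) with h | h
      · have := hzD _ hsD
        rw [h] at h5
        exact absurd h5 this.1
      · exact h
    have h6 := hs2 h4 (h5.trans hsa)
    refine ⟨s, p.symm ⟨(x.1, (p s).1.2), Finset.mem_insert_of_mem h6⟩, ?_, ?_, by simp⟩
    · intro h
      have h7 := hp (p.symm ⟨(x.1, (p s).1.2), Finset.mem_insert_of_mem h6⟩)
      rw [← h] at h7
      have h8 : p s = ⟨(x.1, (p s).1.2), Finset.mem_insert_of_mem h6⟩ := by
        exact (Equiv.eq_symm_apply p).mp h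
      have h9 : (p s).1.1 = x.1 := by rw [h8]
      apply hsx
      rw [← h9, h5]
      exact hsD
    · have h7 := hp (p.symm ⟨(x.1, (p s).1.2), Finset.mem_insert_of_mem h6⟩)
      rw [Equiv.apply_symm_apply] at h7
      have h8 := hzD _ hsD
      generalize p.symm ⟨(x.1, (p s).1.2), Finset.mem_insert_of_mem h6⟩ = w at *
      unfold rowF
      grind

theorem fix_z (hzD : ∀ c ∈ D, z.1 ≠ c.1 ∧ z.2 ≠ c.2)
    (q : Equiv.Perm ↥(insert z D)) (hq : ∀ u, (q u).1.2 = u.1.2)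
    (u : ↥(insert z D)) (hu : u.1 = z) : (q u).1 = z := by
  have h5 := hq u
  rcases eq_z_or (q u) with h | h
  · exact h
  · have := hzD _ h
    rw [hu] at h5
    exact absurd h5.symm this.2

theorem diag_comb (hzD : ∀ c ∈ D, z.1 ≠ c.1 ∧ z.2 ≠ c.2) (a x : ℤ × ℤ)
    (hax : a.2 ≠ x.2) (haD : a ∉ D) (hzx : z.2 ≠ x.2)
    (q : Equiv.Perm ↥(insert z D)) (hq : ∀ u, (q u).1.2 = u.1.2) :
    (∀ u, colF D z a x (q u).1 = colF D z a x u.1) ∨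
      ∃ u w, u ≠ w ∧ rowF D z a x u.1 = rowF D z a x w.1 ∧
        colF D z a x (q u).1 = colF D z a x (q w).1 := by
  by_cases hs : ∀ u : ↥(insert z D), ¬ (u.1 ∈ D ∧ u.1.2 = a.2 ∧ (u.1.1, x.2) ∉ D) →
      ¬ ((q u).1 ∈ D ∧ (q u).1.2 = a.2 ∧ ((q u).1.1, x.2) ∉ D)
  · left
    intro u
    have h1 := hs u
    have h2 := perm_stable q _ hs u
    have h3 := eq_z_or u
    have h4 := eq_z_or (q u)
    have h5 := hq u
    have h6 := hzD u.1
    have h7 := hzD (q u).1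
    unfold colF
    grind
  · right
    push Not at hs
    obtain ⟨t, ht, hqD, hqa, hqx⟩ := hs
    have h5 := hq t
    have h4 : t.1 ∈ D := by
      rcases eq_z_or t with h | h
      · have := hzD _ hqD
        rw [h] at h5
        exact absurd h5.symm this.2
      · exact h
    have h6 := ht h4 (h5.symm.trans hqa)
    refine ⟨t, ⟨(t.1.1, x.2), Finset.mem_insert_of_mem h6⟩, ?_, ?_, ?_⟩
    · intro h
      have : t.1.2 = x.2 := by rw [h]
      grind
    · have := hzD _ h4
      have := hzD _ h6
      have : a = (a.1, a.2) := rfl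
      have : t.1 = (t.1.1, t.1.2) := rfl
      unfold rowF
      grind
    · have h7 := hq ⟨(t.1.1, x.2), Finset.mem_insert_of_mem h6⟩
      generalize q ⟨(t.1.1, x.2), Finset.mem_insert_of_mem h6⟩ = w at *
      have := hzD _ hqD
      unfold colF
      grind

theorem vanish_comb (hzD : ∀ c ∈ D, z.1 ≠ c.1 ∧ z.2 ≠ c.2) (a x b y : ℤ × ℤ)
    (hax : a.2 ≠ x.2) (hzx : z.2 ≠ x.2)
    (H : (b.1, a.2) ∈ D ∨ (b.1, x.2) ∈ D ∨ (y.1, a.2) ∈ D ∨ (y.1, x.2) ∈ D)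
    (q : Equiv.Perm ↥(insert z D)) (hq : ∀ u, (q u).1.2 = u.1.2) :
    ∃ u w, u ≠ w ∧ rowF D z b y u.1 = rowF D z b y w.1 ∧
        colF D z a x (q u).1 = colF D z a x (q w).1 := by
  let zz : ↥(insert z D) := ⟨z, Finset.mem_insert_self _ _⟩
  have hqz : (q zz).1 = z := fix_z hzD q hq zz rfl
  have hcz : colF D z a x (q zz).1 = x.2 := by rw [hqz]; simp [colF]
  have hrz : rowF D z b y zz.1 = y.1 := by simp [rowF, zz]
  -- the easy conflict
  have key1 : ∀ w : ↥(insert z D), w.1 ∈ D → w.1.2 = x.2 → rowF D z b y w.1 = y.1 →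
      ∃ u w, u ≠ w ∧ rowF D z b y u.1 = rowF D z b y w.1 ∧
        colF D z a x (q u).1 = colF D z a x (q w).1 := by
    intro w hw hwx hwr
    refine ⟨zz, w, ?_, by rw [hrz, hwr], ?_⟩
    · intro h
      have := hzD _ hw
      rw [← h] at this
      exact this.1 rfl
    · rw [hcz]
      have := hq w
      unfold colF
      grind
  by_cases hδ : (y.1, x.2) ∈ D
  · refine key1 ⟨(y.1, x.2), Finset.mem_insert_of_mem hδ⟩ hδ rfl ?_
    unfold rowF
    grind
  by_cases hβ : (b.1, x.2) ∈ D
  · refine key1 ⟨(b.1, x.2), Finset.mem_insert_of_mem hβ⟩ hβ rfl ?_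
    unfold rowF
    grind
  by_contra hno
  push Not at hno
  have hS : ∀ u : ↥(insert z D), ¬ (u.1 ∈ D ∧ u.1.2 = a.2 ∧ (u.1.1, x.2) ∉ D) →
      ¬ ((q u).1 ∈ D ∧ (q u).1.2 = a.2 ∧ ((q u).1.1, x.2) ∉ D) := by
    rintro u hu ⟨hqD, hqa, hqx⟩
    have h5 := hq u
    have h4 : u.1 ∈ D := by
      rcases eq_z_or u with h | h
      · have := hzD _ hqD
        rw [h] at h5
        exact absurd h5.symm this.2
      · exact h
    have h6 : (u.1.1, x.2) ∈ D := by
      by_contra h; exact hu ⟨h4, h5.symm.trans hqa, h⟩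
    refine hno u ⟨(u.1.1, x.2), Finset.mem_insert_of_mem h6⟩ ?_ ?_ ?_
    · intro h
      have : u.1.2 = x.2 := by rw [h]
      grind
    · have := hzD _ h4
      have := hzD _ h6
      unfold rowF
      grind
    · have h7 := hq ⟨(u.1.1, x.2), Finset.mem_insert_of_mem h6⟩
      generalize q ⟨(u.1.1, x.2), Finset.mem_insert_of_mem h6⟩ = w at *
      have := hzD _ hqD
      unfold colF
      grind
  have hS' := fun u => mt (perm_stable q _ hS u)
  have key2 : ∀ u : ↥(insert z D), u.1 ∈ D → u.1.2 = a.2 → (u.1.1, x.2) ∉ D →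
      rowF D z b y u.1 = y.1 → False := by
    intro u h1 h2 h3 h4
    have h5 := hS' u (not_not.mpr ⟨h1, h2, h3⟩)
    rw [not_not] at h5
    refine hno zz u ?_ (by rw [hrz, h4]) ?_
    · intro h
      have := hzD _ h1
      rw [← h] at this
      exact this.1 rfl
    · rw [hcz]
      unfold colF
      grind
  by_cases hγ : (y.1, a.2) ∈ D
  · refine key2 ⟨(y.1, a.2), Finset.mem_insert_of_mem hγ⟩ hγ rfl hδ ?_
    unfold rowF
    grind
  · have hα : (b.1, a.2) ∈ D := by tauto
    refine key2 ⟨(b.1, a.2), Finset.mem_insert_of_mem hα⟩ hα rfl hβ ?_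
    unfold rowF
    grind

theorem move_comb (hzD : ∀ c ∈ D, z.1 ≠ c.1 ∧ z.2 ≠ c.2) (a x : ℤ × ℤ)
    (h1 : a.1 ≠ x.1) (h2 : a.2 ≠ x.2) (haD : a ∉ D) (hxD : x ∉ D)
    (haxD : (a.1, x.2) ∉ D) (hxaD : (x.1, a.2) ∉ D) :
    ∃ e : ↥(insert z D) ≃ ↥(jpMove a x (insert a D)),
      (∀ u, (e u).1.1 = rowF D z a x u.1) ∧ (∀ u, (e u).1.2 = colF D z a x u.1) := by
  have haD' : (a.1, a.2) ∉ D := haD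
  have hxD' : (x.1, x.2) ∉ D := hxD
  have hzz : z ∉ D := fun h => (hzD z h).1 rfl
  set f : ℤ × ℤ → ℤ × ℤ := fun c =>
    if c.2 = a.2 ∧ (c.1, x.2) ∉ insert a D then (c.1, x.2) else c with hf
  have hG : colMove a x (insert a D) = (insert a D).image f := rfl
  set G := colMove a x (insert a D) with hGdef
  set h : ℤ × ℤ → ℤ × ℤ := fun c =>
    if c.1 = a.1 ∧ (x.1, c.2) ∉ G then (x.1, c.2) else c with hh
  have hJ : jpMove a x (insert a D) = G.image h := rfl
  have hins : ∀ r, (r, x.2) ∈ insert a D ↔ (r, x.2) ∈ D := by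
    intro r
    rw [Finset.mem_insert]
    constructor
    · rintro (h | h)
      · exact absurd (by rw [← h]) h2
      · exact h
    · exact Or.inr
  have hG1 : ∀ s, s ≠ a.2 → s ≠ x.2 → ((x.1, s) ∈ G ↔ (x.1, s) ∈ D) := by
    intro s hs1 hs2
    rw [hG, Finset.mem_image]
    constructor
    · rintro ⟨c, hc, hc2⟩
      rw [Finset.mem_insert] at hc
      simp only [hf] at hc2
      grind
    · intro hs
      refine ⟨(x.1, s), Finset.mem_insert_of_mem hs, ?_⟩
      simp [hf, hs1]
  have hG2 : (x.1, x.2) ∉ G := by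
    rw [hG, Finset.mem_image]
    rintro ⟨c, hc, hc2⟩
    rw [Finset.mem_insert] at hc
    simp only [hf] at hc2
    have : c = (c.1, c.2) := rfl
    grind
  have hfa : h (f a) = x := by
    have e1 : f a = (a.1, x.2) := by
      show (if a.2 = a.2 ∧ (a.1, x.2) ∉ insert a D then (a.1, x.2) else a) = _
      rw [if_pos ⟨rfl, by rw [hins]; exact haxD⟩]
    rw [e1]
    show (if a.1 = a.1 ∧ (x.1, x.2) ∉ G then (x.1, x.2) else (a.1, x.2)) = _
    rw [if_pos ⟨rfl, hG2⟩]
  have hfD : ∀ c ∈ D, h (f c) = (rowF D z a x c, colF D z a x c) := by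
    intro c hc
    have hcz : c ≠ z := fun h => hzz (h ▸ hc)
    have hce : c = (c.1, c.2) := rfl
    by_cases hca : c.1 = a.1
    · have n1 : c.2 ≠ a.2 := by grind
      have n2 : c.2 ≠ x.2 := by grind
      have e1 : f c = c := by simp only [hf]; rw [if_neg]; tauto
      rw [e1]
      simp only [hh, hca, hG1 c.2 n1 n2, rowF, colF, hcz, n1]
      grind
    · have e1 : f c = (c.1, colF D z a x c) := by
        simp only [hf, colF, hins, hcz]
        grind
      rw [e1]
      simp [hh, rowF, hcz, hca]
  have hall : ∀ u : ↥(insert z D), (rowF D z a x u.1, colF D z a x u.1) ∈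
      jpMove a x (insert a D) := by
    intro u
    rw [hJ, hG, Finset.image_image, Finset.mem_image]
    rcases eq_z_or u with hu | hu
    · refine ⟨a, Finset.mem_insert_self _ _, ?_⟩
      rw [Function.comp, hfa, hu]
      simp [rowF, colF]
    · exact ⟨u.1, Finset.mem_insert_of_mem hu, hfD _ hu⟩
  refine ⟨Equiv.ofBijective (fun u => ⟨_, hall u⟩) ⟨?_, ?_⟩, fun u => rfl, fun u => rfl⟩
  · intro u w huw
    have e1 : rowF D z a x u.1 = rowF D z a x w.1 := congrArg (fun t => t.1.1) huw
    have e2 : colF D z a x u.1 = colF D z a x w.1 := congrArg (fun t => t.1.2) huw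
    apply Subtype.ext
    have hu := eq_z_or u
    have hw := eq_z_or w
    generalize u.1 = u at *
    generalize w.1 = w at *
    clear huw hall hfD hfa hG1 hG2 hins hJ hG
    obtain ⟨u1, u2⟩ := u
    obtain ⟨w1, w2⟩ := w
    unfold rowF at e1
    unfold colF at e2
    grind
  · rintro ⟨t, ht⟩
    rw [hJ, hG, Finset.image_image, Finset.mem_image] at ht
    obtain ⟨c, hc, hct⟩ := ht
    rw [Finset.mem_insert] at hc
    rcases hc with rfl | hc
    · refine ⟨⟨z, Finset.mem_insert_self _ _⟩, Subtype.ext ?_⟩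
      show (rowF D z c x z, colF D z c x z) = t
      rw [← hct, Function.comp, hfa]
      simp [rowF, colF]
    · refine ⟨⟨c, Finset.mem_insert_of_mem hc⟩, Subtype.ext ?_⟩
      show (rowF D z a x c, colF D z a x c) = t
      rw [← hct, Function.comp, hfD _ hc]

end Comb

section Final

variable (V : Type*) [AddCommGroup V] [Module ℂ V]

theorem reindex_symm_cancel {ι κ : Type} (e : ι ≃ κ) (t : ⨂[ℂ] _ : ι, V) :
    PiTensorProduct.reindex ℂ (fun _ : κ => V) e.symm
      (PiTensorProduct.reindex ℂ (fun _ : ι => V) e t) = t := by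
  have h := LinearEquiv.symm_apply_apply (PiTensorProduct.reindex ℂ (fun _ : ι => V) e) t
  rwa [PiTensorProduct.reindex_symm] at h

theorem glOp_mem (D : Finset (ℤ × ℤ)) (g : V ≃ₗ[ℂ] V) (v : ⨂[ℂ] _ : D, V)
    (hv : v ∈ schurModule V D) : glOp V D g v ∈ schurModule V D := by
  obtain ⟨t, rfl⟩ := hv
  refine ⟨glOp V D g t, ?_⟩
  have h : ∀ t, youngOp V D t = rho V (altB (fun u : D => u.1.2) * symA (fun u : D => u.1.1)) t := by
    intro t
    have := youngOp_eq V D (Equiv.refl D) t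
    simpa [PiTensorProduct.reindex_refl] using this
  rw [h, h]
  exact (rho_comm V g _ t).symm

theorem schur_mem_iff (D : Finset (ℤ × ℤ)) (a) (t : ⨂[ℂ] _ : D, V) :
    rho V (altB (fun u : D => u.1.2) * symA (fun u : D => u.1.1) * a) t ∈ schurModule V D := by
  refine ⟨rho V a t, ?_⟩
  have := youngOp_eq V D (Equiv.refl D) (rho V a t)
  rw [map_mul _ _ a]
  simpa [PiTensorProduct.reindex_refl] using this

/-- Embedding of a single Schur module. -/
theorem exists_section {z : ℤ × ℤ} {D : Finset (ℤ × ℤ)}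
    (hzD : ∀ c ∈ D, z.1 ≠ c.1 ∧ z.2 ≠ c.2) (a x : ℤ × ℤ)
    (h1 : a.1 ≠ x.1) (h2 : a.2 ≠ x.2) (haD : a ∉ D) (hxD : x ∉ D)
    (haxD : (a.1, x.2) ∉ D) (hxaD : (x.1, a.2) ∉ D) (hzx : z.2 ≠ x.2) :
    ∃ s : schurModule V (jpMove a x (insert a D)) →ₗ[ℂ] (⨂[ℂ] _ : ↥(insert z D), V),
      (∀ v, s v ∈ schurModule V (insert z D)) ∧
      (∀ g v (h : glOp V _ g v.1 ∈ schurModule V (jpMove a x (insert a D))),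
        s ⟨glOp V _ g v.1, h⟩ = glOp V (insert z D) g (s v)) ∧
      (∀ v, rho V (altB (fun u : ↥(insert z D) => colF D z a x u.1)) (s v) = 0 → v = 0) ∧
      (∀ v, ∃ t, s v = rho V (altB (fun u : ↥(insert z D) => u.1.2) *
        symA (fun u : ↥(insert z D) => rowF D z a x u.1)) t) := by
  obtain ⟨e, he1, he2⟩ := move_comb hzD a x h1 h2 haD hxD haxD hxaD
  obtain ⟨k, hk, hdiag⟩ := diagG (fun u : ↥(insert z D) => colF D z a x u.1)
    (fun u : ↥(insert z D) => u.1.2) (fun u : ↥(insert z D) => rowF D z a x u.1)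
    (fun q hq => diag_comb hzD a x h2 haD hzx q hq)
  obtain ⟨k', hk', hincl⟩ := inclG (fun u : ↥(insert z D) => u.1.2)
    (fun u : ↥(insert z D) => rowF D z a x u.1) (fun u : ↥(insert z D) => u.1.1)
    (fun q hq => incl_comb hzD a x q hq)
  have hy := youngOp_eq V (jpMove a x (insert a D)) e
  simp only [he1, he2] at hy
  set Bi := altB (fun u : ↥(insert z D) => colF D z a x u.1)
  set B0 := altB (fun u : ↥(insert z D) => u.1.2)
  set Ai := symA (fun u : ↥(insert z D) => rowF D z a x u.1)
  set A0 := symA (fun u : ↥(insert z D) => u.1.1)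
  obtain ⟨w, hw⟩ := exists_regular (Bi * Ai)
  refine ⟨(rho V (B0 * Ai * w)) ∘ₗ
    (PiTensorProduct.reindex ℂ (fun _ : ↥(jpMove a x (insert a D)) => V) e.symm).toLinearMap ∘ₗ
    (schurModule V (jpMove a x (insert a D))).subtype, ?_, ?_, ?_, ?_⟩
  · intro v
    have : B0 * Ai * w = B0 * A0 * (k'⁻¹ • (Ai * w)) := by
      rw [mul_smul_comm, ← mul_assoc, hincl, smul_mul_assoc, smul_smul, inv_mul_cancel₀ hk',
        one_smul]
    rw [this]
    exact schur_mem_iff V _ _ _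
  · intro g v h
    simp only [LinearMap.comp_apply, Submodule.subtype_apply, LinearEquiv.coe_coe, glOp]
    rw [rho_comm]
    congr 1
    exact (PiTensorProduct.map_reindex (fun _ : ↥(jpMove a x (insert a D)) => g.toLinearMap)
      e.symm v.1).symm
  · rintro ⟨v, t, rfl⟩ h0
    simp only [LinearMap.comp_apply, Submodule.subtype_apply, LinearEquiv.coe_coe, hy,
      reindex_symm_cancel] at h0
    rw [← Module.End.mul_apply, ← Module.End.mul_apply, ← map_mul, ← map_mul] at h0
    have e1 : Bi * (B0 * Ai * w) * (Bi * Ai) = k • (Bi * Ai) := by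
      rw [← mul_assoc Bi, ← mul_assoc Bi, hdiag, smul_mul_assoc, smul_mul_assoc, hw]
    rw [e1, map_smul, LinearMap.smul_apply, smul_eq_zero] at h0
    apply Subtype.ext
    show youngOp V _ t = 0
    rw [hy, h0.resolve_left hk, map_zero]
  · intro v
    refine ⟨rho V w (PiTensorProduct.reindex ℂ
      (fun _ : ↥(jpMove a x (insert a D)) => V) e.symm v.1), ?_⟩
    rw [← Module.End.mul_apply, ← map_mul]
    rfl

end Final

end CornerAux

/-- For a system of corner configurations `K` for a finite diagram
`D` and a point `z` sharing no row and no column with `D`, the `a`'s, or the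
`Δ`'s, there is an injective `GL(V)`-equivariant linear map
`⊕_{(a,Δ) ∈ K} ⊕_{x ∈ Δ} V[(D ∪ {a})_{a→x}] ↪ V[D ∪ {z}]`. -/
theorem stmt2 (V : Type*) [AddCommGroup V] [Module ℂ V] [FiniteDimensional ℂ V]
    (D : Finset (ℤ × ℤ)) (K : List ((ℤ × ℤ) × List (ℤ × ℤ)))
    (hK : IsCornerSystem D K) (z : ℤ × ℤ)
    (hzD : ∀ c ∈ D, z.1 ≠ c.1 ∧ z.2 ≠ c.2)
    (hzK : ∀ e ∈ K, (z.1 ≠ e.1.1 ∧ z.2 ≠ e.1.2) ∧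
      ∀ x ∈ e.2, z.1 ≠ x.1 ∧ z.2 ≠ x.2) :
    ∃ (hpres : ∀ (g : V ≃ₗ[ℂ] V) (i : Σ p : Fin K.length, Fin (K.get p).2.length),
        ∀ v ∈ schurModule V (cornerDiagram D K i),
          glOp V (cornerDiagram D K i) g v ∈ schurModule V (cornerDiagram D K i))
      (hpresU : ∀ g : V ≃ₗ[ℂ] V, ∀ v ∈ schurModule V (insert z D),
        glOp V (insert z D) g v ∈ schurModule V (insert z D))
      (Φ : ((i : Σ p : Fin K.length, Fin (K.get p).2.length) →
          ↥(schurModule V (cornerDiagram D K i))) →ₗ[ℂ]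
            ↥(schurModule V (insert z D))),
      Function.Injective Φ ∧
      ∀ (g : V ≃ₗ[ℂ] V)
        (v : (i : Σ p : Fin K.length, Fin (K.get p).2.length) →
          ↥(schurModule V (cornerDiagram D K i))),
        Φ (fun i => (glOp V (cornerDiagram D K i) g).restrict (hpres g i) (v i)) =
          (glOp V (insert z D) g).restrict (hpresU g) (Φ v) := by
  classical
  obtain ⟨hK1, -, -, hK4⟩ := hK
  have hmem : ∀ i : (Σ p : Fin K.length, Fin (K.get p).2.length),
      K.get i.1 ∈ K := fun i => List.get_mem _ _
  have hmem2 : ∀ i : (Σ p : Fin K.length, Fin (K.get p).2.length),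
      (K.get i.1).2.get i.2 ∈ (K.get i.1).2 := fun i => List.get_mem _ _
  have hcfg : ∀ i : (Σ p : Fin K.length, Fin (K.get p).2.length),
      (K.get i.1).1.1 ≠ ((K.get i.1).2.get i.2).1 ∧ (K.get i.1).1.2 ≠ ((K.get i.1).2.get i.2).2 := by
    intro i
    exact List.rel_of_pairwise_cons (hK1 _ (hmem i)).1 (hmem2 i)
  have hsec := fun i : (Σ p : Fin K.length, Fin (K.get p).2.length) =>
    CornerAux.exists_section V hzD (K.get i.1).1 ((K.get i.1).2.get i.2) (hcfg i).1 (hcfg i).2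
      ((hK1 _ (hmem i)).2.1 _ List.mem_cons_self)
      ((hK1 _ (hmem i)).2.1 _ (List.mem_cons_of_mem _ (hmem2 i)))
      ((hK1 _ (hmem i)).2.2.1 _ (hmem2 i)).1 ((hK1 _ (hmem i)).2.2.1 _ (hmem2 i)).2
      ((hzK _ (hmem i)).2 _ (hmem2 i)).2
  choose s hs1 hs2 hs3 hs4 using hsec
  refine ⟨fun g i v hv => CornerAux.glOp_mem V _ g v hv,
    fun g v hv => CornerAux.glOp_mem V _ g v hv,
    LinearMap.codRestrict _ (∑ i, (s i) ∘ₗ LinearMap.proj i) ?_, ?_, ?_⟩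
  · intro v
    rw [LinearMap.sum_apply]
    exact Submodule.sum_mem _ fun i _ => hs1 i _
  · rw [← LinearMap.ker_eq_bot, LinearMap.ker_codRestrict, LinearMap.ker_eq_bot']
    intro v hv
    rw [LinearMap.sum_apply] at hv
    change ∑ i, s i (v i) = 0 at hv
    have hsz : ∀ j, v j = 0 → s j (v j) = 0 := by
      intro j hj
      exact (congrArg (s j) hj).trans (map_zero (s j))
    -- strong induction along the lexicographic order
    have key : ∀ (m n : ℕ) (i : Σ p : Fin K.length, Fin (K.get p).2.length),
        i.1.1 = m → i.2.1 = n → v i = 0 := by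
      intro m
      induction m using Nat.strong_induction_on with
      | _ m ihm =>
      intro n
      induction n using Nat.strong_induction_on with
      | _ n ihn =>
      intro i him hin
      apply hs3 i
      have h0 := congrArg (CornerAux.rho V (CornerAux.altB (fun u : ↥(insert z D) =>
        CornerAux.colF D z (K.get i.1).1 ((K.get i.1).2.get i.2) u.1))) hv
      rw [map_zero, map_sum, Finset.sum_eq_single i] at h0
      · exact h0
      · intro j _ hji
        by_cases hlt : j.1.1 < m
        · rw [hsz j (ihm _ hlt j.2.1 j rfl rfl), map_zero]
        by_cases hlt2 : j.1.1 = m ∧ j.2.1 < n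
        · rw [hsz j (ihn _ hlt2.2 j hlt2.1 rfl), map_zero]
        obtain ⟨t, ht⟩ := hs4 j (v j)
        rw [ht, ← Module.End.mul_apply, ← map_mul, ← mul_assoc, CornerAux.vanishG, map_zero,
          LinearMap.zero_apply]
        intro q hq
        refine CornerAux.vanish_comb hzD _ _ _ _ (hcfg i).2 ((hzK _ (hmem i)).2 _ (hmem2 i)).2
          ?_ q hq
        obtain ⟨p, t⟩ := i
        obtain ⟨p', t'⟩ := j
        by_cases hpp : p = p'
        · subst hpp
          right; right; right
          refine (hK1 _ (hmem ⟨p, t⟩)).2.2.2 t t' ?_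
          have : t ≠ t' := by rintro rfl; exact hji rfl
          have : t.1 ≠ t'.1 := fun h => this (Fin.ext h)
          simp only at hin him hlt2 hlt
          rw [Fin.lt_def]
          omega
        · refine hK4 p p' ?_ _ (hmem2 ⟨p, t⟩) _ (hmem2 ⟨p', t'⟩)
          have : p.1 ≠ p'.1 := fun h => hpp (Fin.ext h)
          simp only at him hlt
          rw [Fin.lt_def]
          omega
      · intro h
        exact absurd (Finset.mem_univ _) h
    funext i
    exact key _ _ i rfl rfl
  · intro g v
    apply Subtype.ext
    simp only [LinearMap.codRestrict_apply, LinearMap.coe_restrict_apply, LinearMap.sum_apply, map_sum]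
    refine Finset.sum_congr rfl fun i _ => ?_
    exact hs2 i g (v i) _
end

section
/- Let V be a finite-dimensional complex vector space and let D ⊆ ℤ² be a finite diagram. Then the generalized Schur module V[D] is nonzero if and only if every column of D, i.e., every set {(i,j) ∈ D : j = j₀}, has at most dim V elements. -/
open scoped TensorProduct

lemma youngOp_tprod (V : Type*) [AddCommGroup V] [Module ℂ V]
    (D : Finset (ℤ × ℤ)) (v : D → V) :
    youngOp V D (PiTensorProduct.tprod ℂ v) =
      ∑ p : Equiv.Perm D, ∑ q : Equiv.Perm D,
        if (∀ x : D, ((p x : ℤ × ℤ)).1 = (x : ℤ × ℤ).1) ∧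
            (∀ x : D, ((q x : ℤ × ℤ)).2 = (x : ℤ × ℤ).2) then
          ((Equiv.Perm.sign q : ℤ) : ℂ) •
            PiTensorProduct.tprod ℂ (fun x => v (p.symm (q.symm x)))
        else 0 := by
  unfold youngOp
  rw [LinearMap.sum_apply]
  refine Finset.sum_congr rfl fun p _ => ?_
  rw [LinearMap.sum_apply]
  refine Finset.sum_congr rfl fun q _ => ?_
  split_ifs
  · rw [LinearMap.smul_apply, LinearEquiv.coe_coe]
    erw [PiTensorProduct.reindex_tprod]
    rfl
  · rfl

lemma youngOp_eq_zero (V : Type*) [AddCommGroup V] [Module ℂ V] [FiniteDimensional ℂ V]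
    (D : Finset (ℤ × ℤ)) (j₀ : ℤ)
    (h : Module.finrank ℂ V < (D.filter (fun x => x.2 = j₀)).card) :
    youngOp V D = 0 := by
  classical
  let b := Module.finBasis ℂ V
  apply PiTensorProduct.ext
  refine Module.Basis.ext_multilinear (fun _ => b) fun f => ?_
  simp only [LinearMap.compMultilinearMap_apply, LinearMap.zero_apply]
  rw [youngOp_tprod]
  refine Finset.sum_eq_zero fun p _ => ?_
  obtain ⟨x, hx, y, hy, hxy, hf⟩ : ∃ x ∈ (Finset.univ : Finset D).filter (fun x => x.1.2 = j₀),
      ∃ y ∈ (Finset.univ : Finset D).filter (fun x => x.1.2 = j₀), x ≠ y ∧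
        f (p.symm x) = f (p.symm y) := by
    apply Finset.exists_ne_map_eq_of_card_lt_of_maps_to (t := Finset.univ)
    · have : ((Finset.univ : Finset D).filter (fun x => x.1.2 = j₀)).card =
          (D.filter (fun x => x.2 = j₀)).card := by
        rw [← Finset.card_map (Function.Embedding.subtype _)]
        congr 1
        ext z
        simp
        exact and_comm
      rw [this]
      simpa using h
    · intro _ _
      simp
  simp only [Finset.mem_filter, Finset.mem_univ, true_and] at hx hy
  have hs : ∀ z : D, ((Equiv.swap x y z : D) : ℤ × ℤ).2 = (z : ℤ × ℤ).2 := by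
    intro z
    rw [Equiv.swap_apply_def]
    split_ifs with h1 h2
    · rw [h1, hx, hy]
    · rw [h2, hx, hy]
    · rfl
  have hfs : ∀ z, f (p.symm (Equiv.swap x y z)) = f (p.symm z) := by
    intro z
    rw [Equiv.swap_apply_def]
    split_ifs with h1 h2
    · rw [h1, hf]
    · rw [h2, hf]
    · rfl
  refine Finset.sum_involution (fun q _ => q * Equiv.swap x y) ?_ ?_ ?_ ?_
  · intro q _
    have hiff : (∀ z : D, (((q * Equiv.swap x y) z : D) : ℤ × ℤ).2 = (z : ℤ × ℤ).2) ↔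
        (∀ z : D, ((q z : D) : ℤ × ℤ).2 = (z : ℤ × ℤ).2) := by
      constructor
      · intro H z
        have := H (Equiv.swap x y z)
        simp only [← Equiv.Perm.mul_apply, Equiv.swap_mul_self, mul_assoc, mul_one] at this
        rw [this, hs]
      · intro H z
        rw [Equiv.Perm.mul_apply, H, hs]
    simp only [hiff]
    split_ifs
    · have : ∀ z, (q * Equiv.swap x y).symm z = Equiv.swap x y (q.symm z) := fun z => rfl
      simp only [this, hfs, Equiv.Perm.sign_mul, Equiv.Perm.sign_swap hxy]
      simp
    · simp
  · intro q _ _ h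
    exact hxy (Equiv.swap_eq_one_iff.1 (mul_eq_left.1 h))
  · simp
  · intro q _
    simp [mul_assoc]

lemma youngOp_ne_zero (V : Type*) [AddCommGroup V] [Module ℂ V] [FiniteDimensional ℂ V]
    (D : Finset (ℤ × ℤ))
    (h : ∀ j₀ : ℤ, (D.filter (fun x => x.2 = j₀)).card ≤ Module.finrank ℂ V) :
    youngOp V D ≠ 0 := by
  classical
  let b := Module.finBasis ℂ V
  let u : ℤ → V := fun i => ∑ k : Fin (Module.finrank ℂ V), ((i : ℂ) ^ (k : ℕ)) • b k
  let P : D → Polynomial ℂ := fun x =>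
    Lagrange.basis (D.filter (fun y => y.2 = x.1.2)) (fun y => (y.1 : ℂ)) x.1
  let φ : D → (V →ₗ[ℂ] ℂ) := fun x => ∑ k : Fin (Module.finrank ℂ V), (P x).coeff (k : ℕ) • b.coord k
  have hinj : ∀ x : D, Set.InjOn (fun y : ℤ × ℤ => (y.1 : ℂ))
      (D.filter (fun y => y.2 = x.1.2)) := by
    intro x y hy z hz hyz
    simp only [Finset.coe_filter, Set.mem_ofPred_eq] at hy hz
    have hyz' : (y.1 : ℂ) = (z.1 : ℂ) := hyz
    exact Prod.ext (by exact_mod_cast hyz') (hy.2.trans hz.2.symm)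
  have hmem : ∀ x : D, x.1 ∈ D.filter (fun y => y.2 = x.1.2) := fun x => by simp
  have hφu : ∀ x i, φ x (u i) = (P x).eval (i : ℂ) := by
    intro x i
    have hdeg : (P x).natDegree < Module.finrank ℂ V := by
      have h1 : (P x).natDegree = _ :=
        Polynomial.natDegree_eq_of_degree_eq_some (Lagrange.degree_basis (hinj x) (hmem x))
      have h2 := h x.1.2
      have h3 := Finset.card_pos.2 ⟨_, hmem x⟩
      omega
    rw [Polynomial.eval_eq_sum_range' hdeg, ← Fin.sum_univ_eq_sum_range
      (fun k => (P x).coeff k * (i : ℂ) ^ k)]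
    simp only [φ, u, LinearMap.sum_apply, LinearMap.smul_apply, map_sum, map_smul,
      Module.Basis.coord_apply, Module.Basis.repr_self, smul_eq_mul]
    simp [Finsupp.single_apply, mul_comm]
  have hδ : ∀ x y : D, y.1.2 = x.1.2 → φ x (u y.1.1) = if x = y then 1 else 0 := by
    intro x y hxy
    rw [hφu]
    split_ifs with he
    · subst he
      exact Lagrange.eval_basis_self (hinj x) (hmem x)
    · exact Lagrange.eval_basis_of_ne (v := fun y : ℤ × ℤ => (y.1 : ℂ))
        (fun hh => he (Subtype.ext hh)) (by simp [hxy])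
  let Φ : (⨂[ℂ] _ : D, V) →ₗ[ℂ] ℂ :=
    PiTensorProduct.lift ((MultilinearMap.mkPiAlgebra ℂ D ℂ).compLinearMap φ)
  have hΦ : ∀ w : D → V, Φ (PiTensorProduct.tprod ℂ w) = ∏ x, φ x (w x) := by
    intro w
    simp [Φ]
  intro h0
  have key : Φ (youngOp V D (PiTensorProduct.tprod ℂ fun x => u x.1.1)) =
      ∑ p : Equiv.Perm D,
        if (∀ x : D, ((p x : ℤ × ℤ)).1 = (x : ℤ × ℤ).1) then (1 : ℂ) else 0 := by
    rw [youngOp_tprod, map_sum]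
    refine Finset.sum_congr rfl fun p _ => ?_
    rw [map_sum, Finset.sum_eq_single 1]
    · by_cases hp : ∀ x : D, ((p x : ℤ × ℤ)).1 = (x : ℤ × ℤ).1
      · have hp' : ∀ x : D, ((p.symm x : D) : ℤ × ℤ).1 = (x : ℤ × ℤ).1 := by
          intro x
          rw [← hp (p.symm x), Equiv.apply_symm_apply]
        rw [if_pos ⟨hp, fun _ => rfl⟩, if_pos hp, map_smul, hΦ]
        rw [Finset.prod_eq_one]
        · simp
        · intro x _
          rw [hp']
          exact (hδ x x rfl).trans (if_pos rfl)
      · rw [if_neg (fun H => hp H.1), if_neg hp, map_zero]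
    · intro q _ hq
      split_ifs with H
      · obtain ⟨hp, hqc⟩ := H
        have hp' : ∀ x : D, ((p.symm x : D) : ℤ × ℤ).1 = (x : ℤ × ℤ).1 := by
          intro x
          rw [← hp (p.symm x), Equiv.apply_symm_apply]
        obtain ⟨x, hx⟩ : ∃ x, q x ≠ x := by
          by_contra! hcon
          exact hq (Equiv.ext hcon)
        rw [map_smul, hΦ, Finset.prod_eq_zero (Finset.mem_univ (q x)), smul_zero]
        rw [hp', Equiv.symm_apply_apply, hδ _ _ (hqc x).symm, if_neg hx]
      · exact map_zero _
    · simp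
  rw [h0, LinearMap.zero_apply, map_zero, Finset.sum_boole] at key
  have : (Finset.univ.filter fun p : Equiv.Perm D =>
      ∀ x : D, ((p x : ℤ × ℤ)).1 = (x : ℤ × ℤ).1).card = 0 := by exact_mod_cast key.symm
  rw [Finset.card_eq_zero] at this
  have h1 : (1 : Equiv.Perm D) ∈ (Finset.univ.filter fun p : Equiv.Perm D =>
      ∀ x : D, ((p x : ℤ × ℤ)).1 = (x : ℤ × ℤ).1) := by simp
  rw [this] at h1
  simp at h1

/-- For a finite-dimensional complex vector space `V` and a finite
diagram `D ⊆ ℤ²`, the generalized Schur module `V[D]` is nonzero if and only if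
every column of `D` has at most `dim V` elements. -/
theorem stmt3 (V : Type*) [AddCommGroup V] [Module ℂ V] [FiniteDimensional ℂ V]
    (D : Finset (ℤ × ℤ)) :
    schurModule V D ≠ ⊥ ↔
      ∀ j₀ : ℤ, (D.filter (fun x => x.2 = j₀)).card ≤ Module.finrank ℂ V := by
  unfold schurModule
  rw [Ne, LinearMap.range_eq_bot]
  constructor
  · intro h j₀
    by_contra! hlt
    exact h (youngOp_eq_zero V D j₀ hlt)
  · exact youngOp_ne_zero V D
end
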